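/- Let G = Θ(l_1,l_2,l_3) be a Theta graph with l_1 = min_{i∈[3]} l_i ≥ 1 and l_i ≥ 2 for i ∈ {2,3}, and let 𝓗 be a full m-fold cover of G with m ≥ 3. If l_1, l_2, and l_3 all have the same parity, then P_DP(G,𝓗) ≥ (1/m)·[ (m−1)^{l_1+l_2+l_3} − (m−1)^{l_1} − (m−1)^{l_2} − (m−1)^{l_3} + 2(−1)^{l_1+l_2+l_3} ]. -/

import Mathlib

open Finset

/-- An `m`-fold cover `𝓗 = (L, H)` of `G`, represented (up to isomorphism) on the vertex set
`V × Fin m`, with `L v = {v} × Fin m`.  The fields record that each part `L v` induces a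
clique in `H`, that cross-edges occur only over edges of `G`, and that the cross-edges
between two parts form a (possibly empty) matching. -/
structure DPCover {V : Type*} (G : SimpleGraph V) (m : ℕ) where
  H : SimpleGraph (V × Fin m)
  fiber_clique : ∀ (v : V) (a b : Fin m), a ≠ b → H.Adj (v, a) (v, b)
  cross_only_edges : ∀ (u v : V) (a b : Fin m), u ≠ v → H.Adj (u, a) (v, b) → G.Adj u v
  cross_matching : ∀ (u v : V), u ≠ v → ∀ (a b b' : Fin m),
    H.Adj (u, a) (v, b) → H.Adj (u, a) (v, b') → b = b'

/-- A full `m`-fold cover: every matching between `L u` and `L v` for `uv ∈ E(G)` is perfect. -/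
def DPCover.IsFull {V : Type*} {G : SimpleGraph V} {m : ℕ} (C : DPCover G m) : Prop :=
  ∀ (u v : V), G.Adj u v → ∀ a : Fin m, ∃ b : Fin m, C.H.Adj (u, a) (v, b)

/-- `P_DP(G, 𝓗)`: the number of `𝓗`-colorings of `G`, i.e. of independent sets in `H` of size
`|V(G)|` (equivalently, of independent transversals of the parts `L v`). -/
noncomputable def DPCover.count {V : Type*} {G : SimpleGraph V} {m : ℕ} (C : DPCover G m) : ℕ :=
  Nat.card {c : V → Fin m // ∀ u v : V, u ≠ v → ¬ C.H.Adj (u, c u) (v, c v)}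

/-- The DP color function `P_DP(G, m)`: the minimum of `P_DP(G, 𝓗)` over all
`m`-fold covers `𝓗` of `G`. -/
noncomputable def PDP {V : Type*} (G : SimpleGraph V) (m : ℕ) : ℕ :=
  sInf (Set.range fun C : DPCover G m => C.count)

/-- The dual DP color function `P*_DP(G, m)`: the maximum of `P_DP(G, 𝓗)` over all full
`m`-fold covers `𝓗` of `G`. -/
noncomputable def PDPdual {V : Type*} (G : SimpleGraph V) (m : ℕ) : ℕ :=
  sSup {k : ℕ | ∃ C : DPCover G m, C.IsFull ∧ C.count = k}

/-- The chromatic polynomial `P(G, m)`: the number of proper colorings of `G` with colors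
from `{1, …, m}`. -/
noncomputable def chromP {V : Type*} (G : SimpleGraph V) (m : ℕ) : ℕ :=
  Nat.card {c : V → Fin m // ∀ u v : V, G.Adj u v → c u ≠ c v}

/-- Vertices of the generalized theta graph `Θ(l 0, …, l (n-1))`: two end vertices
`u = Sum.inl false` and `w = Sum.inl true`, and internal vertices `(i, j)` with
`j ∈ {0, …, l i - 2}` for the `i`-th path (listed along the path from `u` to `w`). -/
abbrev ThetaV {n : ℕ} (l : Fin n → ℕ) : Type :=
  Bool ⊕ (Σ i : Fin n, Fin (l i - 1))

/-- The relation generating the edges of the generalized theta graph. -/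
def thetaRel {n : ℕ} (l : Fin n → ℕ) : ThetaV l → ThetaV l → Prop
  | Sum.inl _, Sum.inl _ => ∃ i, l i = 1
  | Sum.inl a, Sum.inr ⟨i, j⟩ => (a = false ∧ (j : ℕ) = 0) ∨ (a = true ∧ (j : ℕ) = l i - 2)
  | Sum.inr _, Sum.inl _ => False
  | Sum.inr ⟨i, j⟩, Sum.inr ⟨i', j'⟩ => i = i' ∧ (j' : ℕ) = (j : ℕ) + 1

/-- The generalized theta graph `Θ(l 0, …, l (n-1))`: two end vertices `u` and `w` joined by
`n` internally disjoint paths, the `i`-th of length `l i`. -/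
def thetaGraph {n : ℕ} (l : Fin n → ℕ) : SimpleGraph (ThetaV l) :=
  SimpleGraph.fromRel (thetaRel l)

/-- The end vertex `u`. -/
def thetaU {n : ℕ} (l : Fin n → ℕ) : ThetaV l := Sum.inl false

/-- The end vertex `w`. -/
def thetaW {n : ℕ} (l : Fin n → ℕ) : ThetaV l := Sum.inl true

/-- The sequence `x, d 0, …, d (n-1), y, y, …` of colors along a path with endpoint colors
`x`, `y` and internal colors `d`. -/
def pathExtend {A : Type*} {n : ℕ} (x y : A) (d : Fin n → A) (k : ℕ) : A :=
  if k = 0 then x else if h : k - 1 < n then d ⟨k - 1, h⟩ else y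

lemma pathExtend_zero {A : Type*} {n : ℕ} (x y : A) (d : Fin n → A) :
    pathExtend x y d 0 = x := by
  simp [pathExtend]

lemma pathExtend_cons_succ {A : Type*} {n : ℕ} (x y z : A) (d : Fin n → A) (k : ℕ) :
    pathExtend x y (Fin.cons z d : Fin (n + 1) → A) (k + 1) = pathExtend z y d k := by
  rcases k with _ | k
  · simp [pathExtend]
  · by_cases h : k < n
    · simpa [pathExtend, h] using Fin.cons_succ (α := fun _ : Fin (n + 1) => A) z d ⟨k, h⟩
    · simp [pathExtend, h]

/-- The number of colorings of the interior of a path with `n` internal vertices, endpoint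
colors `x`, `y`, and forbidden color given by the permutation `P k` on the `k`-th edge. -/
def pathCount {m : ℕ} (n : ℕ) (P : ℕ → Equiv.Perm (Fin m)) (x y : Fin m) : ℚ :=
  ∑ d : Fin n → Fin m, ∏ k ∈ range (n + 1),
    if P k (pathExtend x y d k) = pathExtend x y d (k + 1) then 0 else 1

lemma pathCount_zero {m : ℕ} (P : ℕ → Equiv.Perm (Fin m)) (x y : Fin m) :
    pathCount 0 P x y = if P 0 x = y then 0 else 1 := by
  simp [pathCount, pathExtend]

lemma pathCount_succ {m : ℕ} (n : ℕ) (P : ℕ → Equiv.Perm (Fin m)) (x y : Fin m) :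
    pathCount (n + 1) P x y =
      ∑ z, (if P 0 x = z then 0 else 1) * pathCount n (fun k => P (k + 1)) z y := by
  unfold pathCount
  rw [← (Fin.consEquiv (fun _ : Fin (n + 1) => Fin m)).sum_comp, Fintype.sum_prod_type]
  refine sum_congr rfl fun z _ => ?_
  rw [mul_sum]
  refine sum_congr rfl fun d _ => ?_
  rw [prod_range_succ', mul_comm]
  simp [Fin.consEquiv, pathExtend_cons_succ, pathExtend_zero]

/-- Powers of `J - I` for the `m × m` all-ones matrix `J` have this constant as off-diagonal
entry. -/
def pathCoeff (m n : ℕ) : ℚ := (((m : ℚ) - 1) ^ n - (-1) ^ n) / m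

lemma exists_perm_pathCount_eq {m : ℕ} (hm : 0 < m) (n : ℕ) (P : ℕ → Equiv.Perm (Fin m)) :
    ∃ σ : Equiv.Perm (Fin m), ∀ x y, pathCount n P x y =
      pathCoeff m (n + 1) + (-1) ^ (n + 1) * if σ x = y then 1 else 0 := by
  have hm' : (m : ℚ) ≠ 0 := by positivity
  induction n generalizing P with
  | zero =>
    refine ⟨P 0, fun x y => ?_⟩
    have : pathCoeff m 1 = 1 := by simp [pathCoeff, hm']
    rw [pathCount_zero, zero_add, this]
    split_ifs <;> simp
  | succ n ih =>
    obtain ⟨σ, hσ⟩ := ih fun k => P (k + 1)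
    refine ⟨(P 0).trans σ, fun x y => ?_⟩
    have key : ∀ z, (if P 0 x = z then (0 : ℚ) else 1) *
        (pathCoeff m (n + 1) + (-1) ^ (n + 1) * if σ z = y then 1 else 0) =
        (pathCoeff m (n + 1) + (-1) ^ (n + 1) * if z = σ.symm y then 1 else 0) -
          (if P 0 x = z then (pathCoeff m (n + 1) +
            (-1) ^ (n + 1) * if σ (P 0 x) = y then 1 else 0) else 0) := by
      intro z
      simp only [Equiv.eq_symm_apply]
      split_ifs <;> simp_all
    rw [pathCount_succ, Equiv.trans_apply]
    simp only [hσ, key, sum_sub_distrib, sum_add_distrib, ← mul_sum, sum_ite_eq, sum_ite_eq',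
      mem_univ, if_true, sum_const, card_univ, Fintype.card_fin, nsmul_eq_mul]
    have hc : (m : ℚ) * pathCoeff m (n + 1) + (-1) ^ (n + 1) - pathCoeff m (n + 1) =
        pathCoeff m (n + 1 + 1) := by
      unfold pathCoeff
      field_simp
      ring
    rw [← hc]
    ring

lemma pathCoeff_nonneg {m n : ℕ} (hm : 2 ≤ m) : 0 ≤ pathCoeff m n := by
  have h1 : (1 : ℚ) ≤ (m : ℚ) - 1 := by
    have : (2 : ℚ) ≤ m := by exact_mod_cast hm
    linarith
  have h2 := one_le_pow₀ (n := n) h1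
  have h3 : (-1 : ℚ) ^ n ≤ 1 := by rcases neg_one_pow_eq_or ℚ n with h | h <;> norm_num [h]
  unfold pathCoeff
  apply div_nonneg <;> linarith

lemma one_le_pathCoeff {m n : ℕ} (hm : 2 ≤ m) (hn : 1 ≤ n) (hodd : (-1 : ℚ) ^ n = -1) :
    1 ≤ pathCoeff m n := by
  have h0 : (2 : ℚ) ≤ m := by exact_mod_cast hm
  have h1 : (1 : ℚ) ≤ (m : ℚ) - 1 := by linarith
  have h2 := pow_le_pow_right₀ h1 hn
  unfold pathCoeff
  rw [le_div_iff₀ (by linarith), hodd]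
  linarith

/-- In a full cover the matching over an edge is given by a permutation of the colors. -/
lemma DPCover.IsFull.exists_perm {V : Type*} {G : SimpleGraph V} {m : ℕ} {C : DPCover G m}
    (hC : C.IsFull) {u v : V} (h : G.Adj u v) :
    ∃ P : Equiv.Perm (Fin m), ∀ a b, C.H.Adj (u, a) (v, b) ↔ P a = b := by
  choose f hf using hC u v h
  have hinj : Function.Injective f := fun a a' haa =>
    C.cross_matching v u h.ne' (f a) a a' (hf a).symm (haa ▸ (hf a').symm)
  refine ⟨Equiv.ofBijective f (Finite.injective_iff_bijective.mp hinj), fun a b => ?_⟩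
  exact ⟨fun hab => C.cross_matching u v h.ne a _ _ (hf a) hab, fun hab => hab ▸ hf a⟩

/-- The `k`-th vertex on the `i`-th path of the theta graph, starting from `u`. -/
def thetaPath {n : ℕ} (l : Fin n → ℕ) (i : Fin n) : ℕ → ThetaV l :=
  pathExtend (thetaU l) (thetaW l) fun j => Sum.inr ⟨i, j⟩

lemma apply_thetaPath {n : ℕ} (l : Fin n → ℕ) (i : Fin n) {A : Type*} (c : ThetaV l → A) (k : ℕ) :
    c (thetaPath l i k) =
      pathExtend (c (thetaU l)) (c (thetaW l)) (fun j => c (Sum.inr ⟨i, j⟩)) k := by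
  unfold thetaPath pathExtend
  split_ifs <;> rfl

lemma thetaGraph_adj_thetaPath {n : ℕ} (l : Fin n → ℕ) (i : Fin n) {k : ℕ} (hk : k < l i) :
    (thetaGraph l).Adj (thetaPath l i k) (thetaPath l i (k + 1)) := by
  rw [thetaGraph, SimpleGraph.fromRel_adj]
  rcases k with _ | k
  · by_cases h : 0 < l i - 1
    · simp [thetaPath, pathExtend, thetaU, thetaRel, h]
    · simp only [thetaPath, pathExtend, thetaU, thetaW, thetaRel]
      simp [h]
      exact ⟨i, by omega⟩
  · have h1 : k < l i - 1 := by omega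
    by_cases h : k + 1 < l i - 1
    · simp [thetaPath, pathExtend, thetaRel, h, h1]
    · simp [thetaPath, pathExtend, thetaRel, thetaW, h, h1]
      omega

lemma exists_thetaPath_of_thetaRel {n : ℕ} (l : Fin n → ℕ) {a b : ThetaV l} (hne : a ≠ b)
    (h : thetaRel l a b) : ∃ i k, k < l i ∧
      ((a = thetaPath l i k ∧ b = thetaPath l i (k + 1)) ∨
        (b = thetaPath l i k ∧ a = thetaPath l i (k + 1))) := by
  rcases a with a | ⟨i, j⟩ <;> rcases b with b | ⟨i', j'⟩
  · obtain ⟨i, hi⟩ := h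
    refine ⟨i, 0, by omega, ?_⟩
    cases a <;> cases b <;> simp_all [thetaPath, pathExtend, thetaU, thetaW]
  · have hj := j'.isLt
    rcases h with ⟨rfl, hj0⟩ | ⟨rfl, hj0⟩
    · refine ⟨i', 0, by omega, Or.inl ?_⟩
      have : 0 < l i' - 1 := by omega
      simp [thetaPath, pathExtend, thetaU, this, Fin.ext_iff, hj0]
    · refine ⟨i', j' + 1, by omega, Or.inr ?_⟩
      have : ¬ (j' : ℕ) + 1 < l i' - 1 := by omega
      simp [thetaPath, pathExtend, thetaW, this]
  · exact h.elim
  · obtain ⟨rfl, hj⟩ := h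
    have := j'.isLt
    refine ⟨i, j + 1, by omega, Or.inl ?_⟩
    have h' : (j : ℕ) + 1 < l i - 1 := by omega
    simp [thetaPath, pathExtend, h', Fin.ext_iff, hj]

lemma thetaGraph_adj_iff {n : ℕ} (l : Fin n → ℕ) {a b : ThetaV l} :
    (thetaGraph l).Adj a b ↔ ∃ i k, k < l i ∧
      ((a = thetaPath l i k ∧ b = thetaPath l i (k + 1)) ∨
        (b = thetaPath l i k ∧ a = thetaPath l i (k + 1))) := by
  constructor
  · intro h
    obtain ⟨hne, h | h⟩ := (SimpleGraph.fromRel_adj _ _ _).mp h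
    · exact exists_thetaPath_of_thetaRel l hne h
    · obtain ⟨i, k, hk, h⟩ := exists_thetaPath_of_thetaRel l hne.symm h
      exact ⟨i, k, hk, h.symm⟩
  · rintro ⟨i, k, hk, ⟨rfl, rfl⟩ | ⟨rfl, rfl⟩⟩
    · exact thetaGraph_adj_thetaPath l i hk
    · exact (thetaGraph_adj_thetaPath l i hk).symm

/-- Summing a function of the endpoint colors and of the colors of each path over all colorings
of the theta graph's vertices. -/
lemma sum_thetaV_prod {n m : ℕ} (l : Fin n → ℕ)
    (F : ∀ i : Fin n, Fin m → Fin m → (Fin (l i - 1) → Fin m) → ℚ) :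
    ∑ c : ThetaV l → Fin m,
        ∏ i, F i (c (thetaU l)) (c (thetaW l)) (fun j => c (Sum.inr ⟨i, j⟩)) =
      ∑ x, ∑ y, ∏ i, ∑ d, F i x y d := by
  rw [← (Equiv.sumArrowEquivProdArrow _ _ _).symm.sum_comp, Fintype.sum_prod_type,
    ← (Equiv.boolArrowEquivProd _).symm.sum_comp, Fintype.sum_prod_type]
  refine sum_congr rfl fun x _ => sum_congr rfl fun y _ => ?_
  rw [← (Equiv.piCurry (fun (i : Fin n) (_ : Fin (l i - 1)) => Fin m)).symm.sum_comp,
    Fintype.prod_sum]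
  rfl

/-- The number of colorings of a theta graph from a full cover, as a sum over the colors of
the two end vertices. -/
lemma DPCover.IsFull.exists_count_eq {n m : ℕ} {l : Fin n → ℕ} (hl : ∀ i, 1 ≤ l i) (hm : 0 < m)
    {C : DPCover (thetaGraph l) m} (hC : C.IsFull) :
    ∃ σ : Fin n → Equiv.Perm (Fin m), (C.count : ℚ) =
      ∑ x, ∑ y, ∏ i, (pathCoeff m (l i) + (-1) ^ l i * if σ i x = y then 1 else 0) := by
  classical
  have hP : ∀ i k, ∃ P : Equiv.Perm (Fin m), k < l i → ∀ a b,
      C.H.Adj (thetaPath l i k, a) (thetaPath l i (k + 1), b) ↔ P a = b := by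
    intro i k
    by_cases hk : k < l i
    · obtain ⟨P, hP⟩ := hC.exists_perm (thetaGraph_adj_thetaPath l i hk)
      exact ⟨P, fun _ => hP⟩
    · exact ⟨1, fun h => absurd h hk⟩
  choose P hP using hP
  choose σ hσ using fun i => exists_perm_pathCount_eq hm (l i - 1) (P i)
  refine ⟨σ, ?_⟩
  have hcol : ∀ c : ThetaV l → Fin m, (∀ u v, u ≠ v → ¬ C.H.Adj (u, c u) (v, c v)) ↔
      ∀ i, ∀ k ∈ range (l i - 1 + 1),
        ¬ P i k (c (thetaPath l i k)) = c (thetaPath l i (k + 1)) := by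
    intro c
    constructor
    · intro h i k hk
      have hk : k < l i := by have := hl i; rw [mem_range] at hk; omega
      rw [← hP i k hk]
      exact h _ _ (thetaGraph_adj_thetaPath l i hk).ne
    · intro h u v huv hadj
      have hmem : ∀ {i k}, k < l i → k ∈ range (l i - 1 + 1) := by
        intro i k hk
        rw [mem_range]
        omega
      obtain ⟨i, k, hk, ⟨rfl, rfl⟩ | ⟨rfl, rfl⟩⟩ :=
        (thetaGraph_adj_iff l).mp (C.cross_only_edges u v _ _ huv hadj)
      · exact h i k (hmem hk) ((hP i k hk _ _).mp hadj)
      · exact h i k (hmem hk) ((hP i k hk _ _).mp hadj.symm)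
  have hcount : (C.count : ℚ) = ∑ c : ThetaV l → Fin m, ∏ i, ∏ k ∈ range (l i - 1 + 1),
      if P i k (c (thetaPath l i k)) = c (thetaPath l i (k + 1)) then 0 else 1 := by
    rw [DPCover.count, Nat.card_eq_fintype_card, Fintype.card_subtype, card_filter]
    push_cast
    refine sum_congr rfl fun c _ => ?_
    rw [if_congr (hcol c) rfl rfl]
    split_ifs with h
    · exact (prod_eq_one fun i _ => prod_eq_one fun k hk => if_neg (h i k hk)).symm
    · push Not at h
      obtain ⟨i, k, hk, h⟩ := h
      refine (prod_eq_zero (mem_univ i) ?_).symm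
      exact prod_eq_zero hk (if_pos h)
  simp only [apply_thetaPath] at hcount
  rw [hcount, sum_thetaV_prod l fun i x y d => ∏ k ∈ range (l i - 1 + 1),
    if P i k (pathExtend x y d k) = pathExtend x y d (k + 1) then 0 else 1]
  refine sum_congr rfl fun x _ => sum_congr rfl fun y _ => prod_congr rfl fun i _ => ?_
  have := hσ i x y
  rwa [Nat.sub_add_cancel (hl i)] at this

/-- Let `G = Θ(l_1,l_2,l_3)` with `l_1 = min l_i ≥ 1` and `l_2, l_3 ≥ 2`,
and let `𝓗` be a full `m`-fold cover of `G` with `m ≥ 3`.  If `l_1`, `l_2`, `l_3` all have the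
same parity, then
`P_DP(G,𝓗) ≥ (1/m)·[(m−1)^{l_1+l_2+l_3} − (m−1)^{l_1} − (m−1)^{l_2} − (m−1)^{l_3}
  + 2(−1)^{l_1+l_2+l_3}]`. -/
theorem statement12 (l : Fin 3 → ℕ)
    (hmin : ∀ i : Fin 3, l 0 ≤ l i) (hl1 : 1 ≤ l 0) (hl2 : 2 ≤ l 1) (hl3 : 2 ≤ l 2)
    (m : ℕ) (hm : 3 ≤ m) (C : DPCover (thetaGraph l) m) (hfull : C.IsFull)
    (hpar2 : l 0 % 2 = l 1 % 2) (hpar3 : l 0 % 2 = l 2 % 2) :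
    (C.count : ℚ) ≥
      (1 / (m : ℚ)) *
        (((m : ℚ) - 1) ^ (l 0 + l 1 + l 2) - ((m : ℚ) - 1) ^ (l 0) - ((m : ℚ) - 1) ^ (l 1) -
          ((m : ℚ) - 1) ^ (l 2) + 2 * (-1 : ℚ) ^ (l 0 + l 1 + l 2)) := by
  have hl : ∀ i, 1 ≤ l i := fun i => hl1.trans (hmin i)
  obtain ⟨σ, hσ⟩ := hfull.exists_count_eq hl (by omega)
  have hm2 : 2 ≤ m := by omega
  have hm0 : (m : ℚ) ≠ 0 := by positivity
  obtain ⟨ε, hε⟩ : ∃ ε : ℚ, (-1) ^ l 0 = ε := ⟨_, rfl⟩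
  have hε1 : (-1 : ℚ) ^ l 1 = ε := by
    rw [← hε, neg_one_pow_eq_pow_mod_two, ← hpar2, ← neg_one_pow_eq_pow_mod_two]
  have hε2 : (-1 : ℚ) ^ l 2 = ε := by
    rw [← hε, neg_one_pow_eq_pow_mod_two, ← hpar3, ← neg_one_pow_eq_pow_mod_two]
  have hεor : ε = 1 ∨ ε = -1 := hε ▸ neg_one_pow_eq_or ℚ (l 0)
  obtain ⟨a, ha⟩ : ∃ a, pathCoeff m (l 0) = a := ⟨_, rfl⟩
  obtain ⟨b, hb⟩ : ∃ b, pathCoeff m (l 1) = b := ⟨_, rfl⟩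
  obtain ⟨c, hc⟩ : ∃ c, pathCoeff m (l 2) = c := ⟨_, rfl⟩
  have ha0 : 0 ≤ a := ha ▸ pathCoeff_nonneg hm2
  have hb0 : 0 ≤ b := hb ▸ pathCoeff_nonneg hm2
  have hc0 : 0 ≤ c := hc ▸ pathCoeff_nonneg hm2
  have ha1 : ε = -1 → 1 ≤ a := fun h => ha ▸ one_le_pathCoeff hm2 (hl 0) (hε.trans h)
  have hpt : ∀ x y, a * b * c + ε * (b * c * (if σ 0 x = y then 1 else 0) +
      a * c * (if σ 1 x = y then 1 else 0) + a * b * (if σ 2 x = y then 1 else 0)) ≤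
      ∏ i, (pathCoeff m (l i) + (-1) ^ l i * if σ i x = y then 1 else 0) := by
    intro x y
    rw [Fin.prod_univ_three, hε, hε1, hε2, ha, hb, hc]
    rcases hεor with h | h
    · subst h
      split_ifs <;> linarith
    · have := ha1 h
      subst h
      split_ifs <;> linarith
  have hsum := sum_le_sum fun x (_ : x ∈ univ) => sum_le_sum fun y (_ : y ∈ univ) => hpt x y
  rw [← hσ] at hsum
  simp only [sum_add_distrib, ← mul_sum, sum_ite_eq, mem_univ, if_true, sum_const, card_univ,
    Fintype.card_fin, nsmul_eq_mul] at hsum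
  refine le_of_eq_of_le ?_ hsum
  have hp0 : ((m : ℚ) - 1) ^ l 0 = m * a + ε := by rw [← ha, pathCoeff, hε]; field_simp; ring
  have hp1 : ((m : ℚ) - 1) ^ l 1 = m * b + ε := by rw [← hb, pathCoeff, hε1]; field_simp; ring
  have hp2 : ((m : ℚ) - 1) ^ l 2 = m * c + ε := by rw [← hc, pathCoeff, hε2]; field_simp; ring
  simp only [pow_add, hp0, hp1, hp2, hε, hε1, hε2]
  field_simp
  rcases hεor with rfl | rfl <;> ring
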